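/- For all A, B ∈ Ã₁ and every pair (i,j) ∈ I₁², the restriction (A : B)|_{{i}×I₂²×{j}} of the doubly contracted tensor product defines a bounded operator on ℓ²(I₂), and its operator norm satisfies ‖(A : B)|_{{i}×I₂²×{j}}‖_{B(ℓ²(I₂))} ≤ Σ_{m∈I₁} ‖A|_{{i}×I₂²×{m}}‖_{B(ℓ²(I₂))} ‖B|_{{m}×I₂²×{j}}‖_{B(ℓ²(I₂))}, the series on the right-hand side being convergent. -/

import Mathlib

open scoped ComplexConjugate

noncomputable section

namespace PaperTensor

variable {I I₁ I₂ : Type*}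

/-- The space `ℓ²(I)`. -/
abbrev L2 (I : Type*) := lp (fun _ : I => ℂ) 2

/-- The continuous linear map `T` represents the matrix `M` as an operator on `ℓ²(I)`,
i.e. `(T c) k = Σ_l M k l * c l` for every `c ∈ ℓ²(I)`. -/
def Represents (M : I → I → ℂ) (T : L2 I →L[ℂ] L2 I) : Prop :=
  ∀ c : L2 I, ∀ k : I, HasSum (fun l : I => M k l * (c : ∀ _ : I, ℂ) l) ((T c : ∀ _ : I, ℂ) k)

/-- `M` defines a bounded operator on `ℓ²(I)`. -/
def Bounded2 (M : I → I → ℂ) : Prop := ∃ T : L2 I →L[ℂ] L2 I, Represents M T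

/-- The operator norm `‖M‖_{B(ℓ²(I))}` of the matrix `M` (junk value `0` if `M` is unbounded). -/
noncomputable def opNorm2 (M : I → I → ℂ) : ℝ :=
  letI : Decidable (Bounded2 M) := Classical.propDecidable _
  if h : Bounded2 M then ‖h.choose‖ else 0

/-- The matrix product of two infinite matrices. -/
noncomputable def matMul (A B : I → I → ℂ) : I → I → ℂ :=
  fun i j => ∑' m : I, A i m * B m j

/-- The conjugate transpose of a matrix. -/
def conjTranspose (A : I → I → ℂ) : I → I → ℂ := fun i j => conj (A j i)

/-- A solid Banach algebra of (infinite) matrices over the index set `I`. -/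
structure SolidBanachAlgebra (I : Type*) where
  carrier : Set (I → I → ℂ)
  anorm : (I → I → ℂ) → ℝ
  zero_mem : (0 : I → I → ℂ) ∈ carrier
  add_mem : ∀ A B : I → I → ℂ, A ∈ carrier → B ∈ carrier → A + B ∈ carrier
  smul_mem : ∀ (c : ℂ) (A : I → I → ℂ), A ∈ carrier → c • A ∈ carrier
  mul_mem : ∀ A B : I → I → ℂ, A ∈ carrier → B ∈ carrier → matMul A B ∈ carrier
  anorm_nonneg : ∀ A ∈ carrier, 0 ≤ anorm A
  anorm_zero : anorm 0 = 0
  anorm_eq_zero : ∀ A ∈ carrier, anorm A = 0 → A = 0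
  anorm_smul : ∀ (c : ℂ), ∀ A ∈ carrier, anorm (c • A) = ‖c‖ * anorm A
  anorm_add : ∀ A ∈ carrier, ∀ B ∈ carrier, anorm (A + B) ≤ anorm A + anorm B
  anorm_mul : ∀ A ∈ carrier, ∀ B ∈ carrier, anorm (matMul A B) ≤ anorm A * anorm B
  complete : ∀ f : ℕ → (I → I → ℂ), (∀ n, f n ∈ carrier) →
      (∀ ε > (0 : ℝ), ∃ N : ℕ, ∀ m ≥ N, ∀ n ≥ N, anorm (f m - f n) < ε) →
      ∃ A ∈ carrier, ∀ ε > (0 : ℝ), ∃ N : ℕ, ∀ n ≥ N, anorm (f n - A) < ε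
  bounded : ∀ A ∈ carrier, Bounded2 A
  solid : ∀ A ∈ carrier, ∀ B : I → I → ℂ,
      (∀ i j, ‖B i j‖ ≤ ‖A i j‖) → B ∈ carrier ∧ anorm B ≤ anorm A

/-- A matrix algebra is involutive if it is closed under conjugate transposition and the
norm is invariant under it. -/
def SolidBanachAlgebra.Involutive (𝒜 : SolidBanachAlgebra I) : Prop :=
  ∀ A ∈ 𝒜.carrier, conjTranspose A ∈ 𝒜.carrier ∧ 𝒜.anorm (conjTranspose A) = 𝒜.anorm A

/-- Rank-four tensors `(A_{i,k,l,j})` indexed by `I₁ × I₂² × I₁`. -/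
abbrev Tensor (I₁ I₂ : Type*) := I₁ → I₂ → I₂ → I₁ → ℂ

/-- The restriction `A|_{{i} × I₂² × {j}}`, an `I₂ × I₂` matrix. -/
def res1 (A : Tensor I₁ I₂) (i j : I₁) : I₂ → I₂ → ℂ := fun k l => A i k l j

/-- The restriction `A|_{I₁ × {(k,l)} × I₁}`, an `I₁ × I₁` matrix. -/
def res2 (A : Tensor I₁ I₂) (k l : I₂) : I₁ → I₁ → ℂ := fun i j => A i k l j

/-- Membership in `Ã₁`, for a set `S` of `I₁ × I₁` matrices playing the role of `𝒜₁`: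
all restrictions `A|_{{i} × I₂² × {j}}` are bounded on `ℓ²(I₂)` and the matrix of their
operator norms belongs to `S`. -/
def MemT1 (S : Set (I₁ → I₁ → ℂ)) (A : Tensor I₁ I₂) : Prop :=
  (∀ i j : I₁, Bounded2 (res1 A i j)) ∧
    (fun i j : I₁ => (opNorm2 (res1 A i j) : ℂ)) ∈ S

/-- Membership in `Ã₂`. -/
def MemT2 (S : Set (I₂ → I₂ → ℂ)) (A : Tensor I₁ I₂) : Prop :=
  (∀ k l : I₂, Bounded2 (res2 A k l)) ∧
    (fun k l : I₂ => (opNorm2 (res2 A k l) : ℂ)) ∈ S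

/-- The norm `‖A‖_{Ã₁}` (meaningful on members of `Ã₁`). -/
noncomputable def normT1 (𝒜₁ : SolidBanachAlgebra I₁) (A : Tensor I₁ I₂) : ℝ :=
  𝒜₁.anorm (fun i j : I₁ => (opNorm2 (res1 A i j) : ℂ))

/-- The norm `‖A‖_{Ã₂}` (meaningful on members of `Ã₂`). -/
noncomputable def normT2 (𝒜₂ : SolidBanachAlgebra I₂) (A : Tensor I₁ I₂) : ℝ :=
  𝒜₂.anorm (fun k l : I₂ => (opNorm2 (res2 A k l) : ℂ))

/-- Membership in `𝒜 = Ã₁ ∩ Ã₂`. -/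
def MemA (𝒜₁ : SolidBanachAlgebra I₁) (𝒜₂ : SolidBanachAlgebra I₂) (A : Tensor I₁ I₂) : Prop :=
  MemT1 𝒜₁.carrier A ∧ MemT2 𝒜₂.carrier A

/-- The norm `‖A‖_𝒜 = max {‖A‖_{Ã₁}, ‖A‖_{Ã₂}}`. -/
noncomputable def normA (𝒜₁ : SolidBanachAlgebra I₁) (𝒜₂ : SolidBanachAlgebra I₂)
    (A : Tensor I₁ I₂) : ℝ :=
  max (normT1 𝒜₁ A) (normT2 𝒜₂ A)

/-- The matrix over `I₁ × I₂` through which a rank-four tensor acts on `ℓ²(I₁ × I₂)`: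
`(Ac)_{(i,k)} = Σ_{(m,n)} A_{i,k,n,m} c_{(m,n)}`. -/
def toMatrix (A : Tensor I₁ I₂) : (I₁ × I₂) → (I₁ × I₂) → ℂ :=
  fun p q => A p.1 p.2 q.2 q.1

/-- The rank-four tensor of matrix entries of an operator `T` on `ℓ²(I₁ × I₂)`:
its `(i,k,l,j)` entry is the `((i,k),(j,l))` matrix entry of `T`. -/
noncomputable def entryTensor (T : L2 (I₁ × I₂) →L[ℂ] L2 (I₁ × I₂)) : Tensor I₁ I₂ :=
  letI : DecidableEq (I₁ × I₂) := Classical.decEq _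
  fun i k l j => (T (lp.single 2 (j, l) (1 : ℂ)) : ∀ _ : I₁ × I₂, ℂ) (i, k)

/-- A set `S` of rank-four tensors is inverse-closed if, whenever `A ∈ S` acts as a boundedly
invertible operator on `ℓ²(I₁ × I₂)`, the rank-four tensor of matrix entries of the inverse
operator also belongs to `S`. -/
def InverseClosed (S : Set (Tensor I₁ I₂)) : Prop :=
  ∀ A ∈ S, ∀ T Tinv : L2 (I₁ × I₂) →L[ℂ] L2 (I₁ × I₂),
    Represents (toMatrix A) T →
    T.comp Tinv = ContinuousLinearMap.id ℂ (L2 (I₁ × I₂)) →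
    Tinv.comp T = ContinuousLinearMap.id ℂ (L2 (I₁ × I₂)) →
    entryTensor Tinv ∈ S

/-- The doubly contracted tensor product
`(A : B)_{i,k,l,j} = Σ_{n ∈ I₂} Σ_{m ∈ I₁} A_{i,k,n,m} B_{m,n,l,j}`. -/
noncomputable def contract (A B : Tensor I₁ I₂) : Tensor I₁ I₂ :=
  fun i k l j => ∑' n : I₂, ∑' m : I₁, A i k n m * B m n l j

/-- Absolute convergence of all series defining the doubly contracted tensor product. -/
def ContractSummable (A B : Tensor I₁ I₂) : Prop :=
  ∀ (i : I₁) (k l : I₂) (j : I₁),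
    Summable (fun nm : I₂ × I₁ => ‖A i k nm.1 nm.2 * B nm.2 nm.1 l j‖)

/-- The adjoint tensor `(A*)_{i,k,l,j} = conj (A_{j,l,k,i})`. -/
def adjT (A : Tensor I₁ I₂) : Tensor I₁ I₂ := fun i k l j => conj (A j l k i)


theorem Represents.unique {M : I → I → ℂ} {T S : L2 I →L[ℂ] L2 I}
    (hT : Represents M T) (hS : Represents M S) : T = S := by
  ext c k
  exact (hT c k).unique (hS c k)

theorem Represents.opNorm2_eq {M : I → I → ℂ} {T : L2 I →L[ℂ] L2 I} (hT : Represents M T) :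
    opNorm2 M = ‖T‖ := by
  have h : Bounded2 M := ⟨T, hT⟩
  rw [opNorm2, dif_pos h, h.choose_spec.unique hT]

theorem opNorm2_nonneg (M : I → I → ℂ) : 0 ≤ opNorm2 M := by
  unfold opNorm2
  split_ifs
  exacts [norm_nonneg _, le_rfl]

theorem Represents.apply_single [DecidableEq I] {M : I → I → ℂ} {T : L2 I →L[ℂ] L2 I}
    (hT : Represents M T) (k l : I) : T (lp.single 2 l (1 : ℂ)) k = M k l := by
  have h := hasSum_single (f := fun n => M k n * lp.single (E := fun _ : I => ℂ) 2 l 1 n) l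
    fun n hn => by simp [Pi.single_eq_of_ne hn]
  simpa using (hT _ k).unique h

/-- A bounded operator on `ℓ²(I)` is represented by the matrix of its entries. -/
theorem represents_of_apply_single [DecidableEq I] {M : I → I → ℂ} {T : L2 I →L[ℂ] L2 I}
    (h : ∀ k l, T (lp.single 2 l (1 : ℂ)) k = M k l) : Represents M T := by
  intro c k
  have hc := ((lp.evalCLM ℂ (fun _ : I => ℂ) 2 k).comp T).hasSum
    (lp.hasSum_single (by simp) c)
  refine hc.congr_fun fun l => ?_
  have : lp.single 2 l (c l) = c l • lp.single (E := fun _ : I => ℂ) 2 l (1 : ℂ) := by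
    rw [← lp.single_smul]; simp
  change _ = T (lp.single 2 l (c l)) k
  rw [this, map_smul, ← h k l, mul_comm]
  rfl

/-- The products of a row of a bounded matrix with a square summable sequence are absolutely
summable, with sum at most the product of the norms. -/
theorem Represents.summable_norm_mul {M : I → I → ℂ} {T : L2 I →L[ℂ] L2 I}
    (hT : Represents M T) (c : L2 I) (k : I) :
    Summable (fun n => ‖M k n * c n‖) ∧ ∑' n, ‖M k n * c n‖ ≤ ‖T‖ * ‖c‖ := by
  choose p hp hpc using fun n => Complex.exists_norm_eq_mul_self (M k n * c n)
  have hle : ∀ n, ‖p n * c n‖ ≤ ‖c n‖ := fun n => by simp [hp]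
  let d : L2 I := ⟨fun n => p n * c n, (lp.memℓp c).mono' hle⟩
  have hd : ‖d‖ ≤ ‖c‖ := lp.norm_mono (by simp) hle
  have hs : HasSum (fun n => ((‖M k n * c n‖ : ℝ) : ℂ)) (T d k) :=
    (hT d k).congr_fun fun n => by rw [hpc]; change _ = M k n * (p n * c n); ring
  have hsum : Summable (fun n => ‖M k n * c n‖) := Complex.summable_ofReal.1 hs.summable
  refine ⟨hsum, ?_⟩
  calc ∑' n, ‖M k n * c n‖ = ‖T d k‖ := by
        rw [← hs.tsum_eq, ← Complex.ofReal_tsum, Complex.norm_real, Real.norm_of_nonneg]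
        exact tsum_nonneg fun n => norm_nonneg _
    _ ≤ ‖T d‖ := lp.norm_apply_le_norm (by simp) _ _
    _ ≤ ‖T‖ * ‖c‖ := T.le_opNorm_of_le hd

/-- The entries of the product of two bounded matrices are absolutely convergent series. -/
theorem Bounded2.summable_mul {M N : I → I → ℂ} (hM : Bounded2 M) (hN : Bounded2 N) (i j : I) :
    Summable (fun m => M i m * N m j) := by
  classical
  obtain ⟨T, hT⟩ := hM
  obtain ⟨S, hS⟩ := hN
  simpa only [hS.apply_single] using (hT (S (lp.single 2 j 1)) i).summable

theorem _root_.HasSum.lp_apply {ι : Type*} {f : ι → L2 I →L[ℂ] L2 I} {T : L2 I →L[ℂ] L2 I}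
    (h : HasSum f T) (c : L2 I) (k : I) : HasSum (fun m => f m c k) (T c k) :=
  (lp.evalCLM ℂ (fun _ : I => ℂ) 2 k).hasSum
    ((ContinuousLinearMap.apply ℂ (L2 I) c).hasSum h)

/-- If the products of the norms of the operators represented by the restrictions of `A` and `B`
are summable, then the sum of the composed operators represents the restriction of `A : B`. -/
theorem represents_res1_contract {A B : Tensor I₁ I₂} {i j : I₁}
    {T S : I₁ → L2 I₂ →L[ℂ] L2 I₂} (hT : ∀ m, Represents (res1 A i m) (T m))
    (hS : ∀ m, Represents (res1 B m j) (S m)) (hsum : Summable fun m => ‖T m‖ * ‖S m‖) :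
    Represents (res1 (contract A B) i j) (∑' m, (T m).comp (S m)) := by
  classical
  have hop : Summable fun m => (T m).comp (S m) :=
    .of_norm_bounded hsum fun m => (T m).opNorm_comp_le (S m)
  refine represents_of_apply_single fun k l => ?_
  let e : L2 I₂ := lp.single 2 l (1 : ℂ)
  have he : ‖e‖ = 1 := by simp [e, lp.norm_single]
  have hSe : ∀ m n, S m e n = B m n l j := fun m n => (hS m).apply_single n l
  have hrow : ∀ m, Summable (fun n => ‖A i k n m * B m n l j‖) ∧
      ∑' n, ‖A i k n m * B m n l j‖ ≤ ‖T m‖ * ‖S m‖ := fun m => by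
    obtain ⟨h, hb⟩ := (hT m).summable_norm_mul (S m e) k
    simp only [hSe] at h hb
    refine ⟨h, hb.trans ?_⟩
    gcongr
    simpa [he] using (S m).le_opNorm e
  have hprod : Summable fun p : I₁ × I₂ => A i k p.2 p.1 * B p.1 p.2 l j := by
    refine .of_norm ((summable_prod_of_nonneg fun _ => norm_nonneg _).2
      ⟨fun m => (hrow m).1, ?_⟩)
    exact hsum.of_nonneg_of_le (fun m => tsum_nonneg fun n => norm_nonneg _) fun m => (hrow m).2
  have hentry : HasSum (fun m => T m (S m e) k) ((∑' m, (T m).comp (S m)) e k) :=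
    hop.hasSum.lp_apply e k
  calc (∑' m, (T m).comp (S m)) e k = ∑' m, ∑' n, A i k n m * B m n l j := by
        rw [← hentry.tsum_eq]
        refine tsum_congr fun m => ?_
        rw [← (hT m (S m e) k).tsum_eq]
        simp only [hSe, res1]
    _ = ∑' n, ∑' m, A i k n m * B m n l j :=
        Summable.tsum_comm (f := fun n m => A i k n m * B m n l j) hprod.prod_symm

/-- for `A, B ∈ Ã₁` each restriction of `A : B` is bounded on `ℓ²(I₂)` with the
stated convergent series bound on its operator norm. -/
theorem statement12 {I₁ I₂ : Type*} [Countable I₁] [Countable I₂]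
    (𝒜₁ : SolidBanachAlgebra I₁)
    (A B : Tensor I₁ I₂) (hA : MemT1 𝒜₁.carrier A) (hB : MemT1 𝒜₁.carrier B)
    (i j : I₁) :
    Bounded2 (res1 (contract A B) i j) ∧
    Summable (fun m : I₁ => opNorm2 (res1 A i m) * opNorm2 (res1 B m j)) ∧
    opNorm2 (res1 (contract A B) i j) ≤
      ∑' m : I₁, opNorm2 (res1 A i m) * opNorm2 (res1 B m j) := by
  choose T hT using hA.1 i
  choose S hS using fun m => hB.1 m j
  have hsum : Summable fun m => opNorm2 (res1 A i m) * opNorm2 (res1 B m j) := by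
    have h := (𝒜₁.bounded _ hA.2).summable_mul (𝒜₁.bounded _ hB.2) i j
    exact Complex.summable_ofReal.1 (by simpa using h)
  have hnorm : ∀ m, opNorm2 (res1 A i m) * opNorm2 (res1 B m j) = ‖T m‖ * ‖S m‖ := fun m => by
    rw [(hT m).opNorm2_eq, (hS m).opNorm2_eq]
  have hrep := represents_res1_contract hT hS (by simpa only [hnorm] using hsum)
  refine ⟨⟨_, hrep⟩, hsum, ?_⟩
  rw [hrep.opNorm2_eq]
  refine tsum_of_norm_bounded hsum.hasSum fun m => ?_
  rw [hnorm]
  exact (T m).opNorm_comp_le (S m)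

end PaperTensor
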